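/- Let N ≥ 1 and let f, g, h : ℝ → ℝ be N-times differentiable functions satisfying det [[1,1,1],[f(x),g(y),h(z)],[f'(x),g'(y),h'(z)]] = 0 for all real x, y, z with x + y + z = 0. With aₖ(x,y) = g⁽ᵏ⁻¹⁾(y) + (−1)ᵏ f⁽ᵏ⁻¹⁾(x), bₖ(x,y) = g⁽ᵏ⁾(y) + (−1)ᵏ f⁽ᵏ⁾(x), cₖ(x,y) = Σ_{j=0}^{k} C(k,j) (−1)ʲ f⁽ʲ⁾(x) g⁽ᵏ⁻ʲ⁾(y), one has, for all 1 ≤ k, l, s ≤ N and all real x, y: det [[aₖ, aₗ, aₛ],[bₖ, bₗ, bₛ],[cₖ, cₗ, cₛ]] = 0 (all entries evaluated at (x,y)). -/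

import Mathlib

/-- `aₖ(x,y) = g⁽ᵏ⁻¹⁾(y) + (−1)ᵏ f⁽ᵏ⁻¹⁾(x)`, i.e. `∂^(k-1)(g(y) − f(x))`
with `∂ = ∂_y − ∂_x`. -/
noncomputable def aFun (f g : ℝ → ℝ) (k : ℕ) (x y : ℝ) : ℝ :=
  iteratedDeriv (k - 1) g y + (-1 : ℝ) ^ k * iteratedDeriv (k - 1) f x

/-- `bₖ(x,y) = g⁽ᵏ⁾(y) + (−1)ᵏ f⁽ᵏ⁾(x)`, i.e. `∂^k(g(y) + f(x))`. -/
noncomputable def bFun (f g : ℝ → ℝ) (k : ℕ) (x y : ℝ) : ℝ :=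
  iteratedDeriv k g y + (-1 : ℝ) ^ k * iteratedDeriv k f x

/-- `cₖ(x,y) = Σ_{j=0}^{k} C(k,j) (−1)ʲ f⁽ʲ⁾(x) g⁽ᵏ⁻ʲ⁾(y)`, i.e. `∂^k(g(y)·f(x))`. -/
noncomputable def cFun (f g : ℝ → ℝ) (k : ℕ) (x y : ℝ) : ℝ :=
  ∑ j ∈ Finset.range (k + 1),
    (k.choose j : ℝ) * (-1 : ℝ) ^ j * iteratedDeriv j f x * iteratedDeriv (k - j) g y

section

variable {f g : ℝ → ℝ}

lemma hasDerivAt_iteratedDeriv_sub {i : ℕ} (hf : Differentiable ℝ (iteratedDeriv i f)) (x t : ℝ) :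
    HasDerivAt (fun t => iteratedDeriv i f (x - t)) (-iteratedDeriv (i + 1) f (x - t)) t := by
  have h := (hf (x - t)).hasDerivAt.comp_const_sub x t
  rwa [← iteratedDeriv_succ] at h

lemma hasDerivAt_iteratedDeriv_add {i : ℕ} (hg : Differentiable ℝ (iteratedDeriv i g)) (y t : ℝ) :
    HasDerivAt (fun t => iteratedDeriv i g (y + t)) (iteratedDeriv (i + 1) g (y + t)) t := by
  have h := (hg (y + t)).hasDerivAt.comp_const_add y t
  rwa [← iteratedDeriv_succ] at h

lemma hasDerivAt_bFun {k : ℕ} (hf : Differentiable ℝ (iteratedDeriv k f))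
    (hg : Differentiable ℝ (iteratedDeriv k g)) (x y t : ℝ) :
    HasDerivAt (fun t => bFun f g k (x - t) (y + t)) (bFun f g (k + 1) (x - t) (y + t)) t := by
  unfold bFun
  refine ((hasDerivAt_iteratedDeriv_add hg y t).fun_add
    ((hasDerivAt_iteratedDeriv_sub hf x t).const_mul ((-1 : ℝ) ^ k))).congr_deriv ?_
  ring

lemma hasDerivAt_aFun {k : ℕ} (hf : Differentiable ℝ (iteratedDeriv k f))
    (hg : Differentiable ℝ (iteratedDeriv k g)) (x y t : ℝ) :
    HasDerivAt (fun t => aFun f g (k + 1) (x - t) (y + t))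
      (aFun f g (k + 2) (x - t) (y + t)) t := by
  unfold aFun
  refine ((hasDerivAt_iteratedDeriv_add hg y t).fun_add
    ((hasDerivAt_iteratedDeriv_sub hf x t).const_mul ((-1 : ℝ) ^ (k + 1)))).congr_deriv ?_
  simp only [Nat.add_succ_sub_one]
  ring

lemma cFun_succ (k : ℕ) (x y : ℝ) :
    cFun f g (k + 1) x y = ∑ j ∈ Finset.range (k + 1), (k.choose j : ℝ) * (-1 : ℝ) ^ j *
      (-iteratedDeriv (j + 1) f x * iteratedDeriv (k - j) g y +
        iteratedDeriv j f x * iteratedDeriv (k - j + 1) g y) := by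
  have h := Finset.sum_choose_succ_mul
    (fun i j => (-1 : ℝ) ^ i * iteratedDeriv i f x * iteratedDeriv j g y) k
  simp only [← mul_assoc] at h
  rw [cFun, h, ← Finset.sum_add_distrib]
  refine Finset.sum_congr rfl fun j hj => ?_
  rw [Nat.sub_add_comm (Finset.mem_range_succ_iff.mp hj)]
  ring

lemma hasDerivAt_cFun {k : ℕ} (hf : ∀ i ≤ k, Differentiable ℝ (iteratedDeriv i f))
    (hg : ∀ i ≤ k, Differentiable ℝ (iteratedDeriv i g)) (x y t : ℝ) :
    HasDerivAt (fun t => cFun f g k (x - t) (y + t)) (cFun f g (k + 1) (x - t) (y + t)) t := by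
  rw [cFun_succ]
  unfold cFun
  refine HasDerivAt.fun_sum fun j hj => ?_
  have hj := Finset.mem_range_succ_iff.mp hj
  refine (((hasDerivAt_iteratedDeriv_sub (hf j hj) x t).const_mul
    ((k.choose j : ℝ) * (-1 : ℝ) ^ j)).fun_mul
    (hasDerivAt_iteratedDeriv_add (hg (k - j) (k.sub_le j)) y t)).congr_deriv ?_
  ring

/-- A linear relation between `a₁`, `b₁`, `c₁` with coefficients depending only on `x + y` is
inherited by `aₖ`, `bₖ`, `cₖ`, since `∂_y - ∂_x` annihilates the coefficients. -/
lemma linear_relation {N : ℕ} {p q : ℝ → ℝ}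
    (hf : ∀ i < N, Differentiable ℝ (iteratedDeriv i f))
    (hg : ∀ i < N, Differentiable ℝ (iteratedDeriv i g))
    (h1 : ∀ x y, p (x + y) * aFun f g 1 x y + q (x + y) * bFun f g 1 x y + cFun f g 1 x y = 0)
    (k : ℕ) (hk : k < N) (x y : ℝ) :
    p (x + y) * aFun f g (k + 1) x y + q (x + y) * bFun f g (k + 1) x y
      + cFun f g (k + 1) x y = 0 := by
  induction k generalizing x y with
  | zero => exact h1 x y
  | succ k ih =>
    have hd := (((hasDerivAt_aFun (hf k (by lia)) (hg k (by lia)) x y 0).const_mul (p (x + y))).add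
      ((hasDerivAt_bFun (hf _ hk) (hg _ hk) x y 0).const_mul (q (x + y)))).add
      (hasDerivAt_cFun (k := k + 1) (fun i hi => hf i (by lia)) (fun i hi => hg i (by lia)) x y 0)
    have h0 := hd.unique <| (hasDerivAt_const (0 : ℝ) (0 : ℝ)).congr_of_eventuallyEq <|
      .of_forall fun t => by
        have := ih (by lia) (x - t) (y + t)
        rwa [sub_add_add_cancel] at this
    simpa using h0

end

theorem stmt_10 (N : ℕ) (hN : 1 ≤ N) (f g h : ℝ → ℝ)
    (hf : ∀ i < N, Differentiable ℝ (iteratedDeriv i f))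
    (hg : ∀ i < N, Differentiable ℝ (iteratedDeriv i g))
    (hh : ∀ i < N, Differentiable ℝ (iteratedDeriv i h))
    (heq : ∀ x y z : ℝ, x + y + z = 0 →
      Matrix.det !![(1 : ℝ), 1, 1; f x, g y, h z; deriv f x, deriv g y, deriv h z] = 0) :
    ∀ k l s : ℕ, 1 ≤ k → k ≤ N → 1 ≤ l → l ≤ N → 1 ≤ s → s ≤ N → ∀ x y : ℝ,
      Matrix.det !![aFun f g k x y, aFun f g l x y, aFun f g s x y;
                    bFun f g k x y, bFun f g l x y, bFun f g s x y;
                    cFun f g k x y, cFun f g l x y, cFun f g s x y] = 0 := by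
  have key := linear_relation (p := fun u => deriv h (-u)) (q := fun u => -h (-u)) hf hg
    fun x y => by
      have := heq x y (-(x + y)) (by ring)
      simp [Matrix.det_fin_three, -neg_add_rev] at this
      simp [aFun, bFun, cFun, -neg_add_rev, Finset.sum_range_succ]
      linear_combination this
  intro k l s hk hkN hl hlN hs hsN x y
  obtain ⟨k, rfl⟩ := Nat.exists_eq_add_of_le' hk
  obtain ⟨l, rfl⟩ := Nat.exists_eq_add_of_le' hl
  obtain ⟨s, rfl⟩ := Nat.exists_eq_add_of_le' hs
  refine Matrix.exists_vecMul_eq_zero_iff.mp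
    ⟨![deriv h (-(x + y)), -h (-(x + y)), 1], fun h0 => by simpa using congrFun h0 2, ?_⟩
  ext i
  fin_cases i
  · simpa [-neg_add_rev, Matrix.vecMul, dotProduct, Fin.sum_univ_three] using key k hkN x y
  · simpa [-neg_add_rev, Matrix.vecMul, dotProduct, Fin.sum_univ_three] using key l hlN x y
  · simpa [-neg_add_rev, Matrix.vecMul, dotProduct, Fin.sum_univ_three] using key s hsN x y
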